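/- Let n ≥ 1 be an integer, let ζ ∈ ℂ be a primitive nth root of unity, let a ∈ ℂ with a^n ≠ 1, let ℓ ≥ 0 be an integer, and set q = ζ and L = ζ^ℓ. Then −qL²(1+L)(1+4L+L²)(1−qL)³(1−La)²(1−qLa)²·F_n(a,ζ;ℓ+2,ℓ+2) + (1−qL²)·[1 + 5(1+q)L + (5+16q+5q²)L² + (1+q)(1−5q+q²)L³ − 2q(3+25q+3q²)L⁴ + q(1+q)(1−5q+q²)L⁵ + q²(5+16q+5q²)L⁶ + 5q³(1+q)L⁷ + q⁴L⁸]·(1−La)²(a−qL)²·F_n(a,ζ;ℓ+1,ℓ+1) − qL²(1−L)³(1+qL)(1+4qL+q²L²)(a−L)²(a−qL)²·F_n(a,ζ;ℓ,ℓ) = 0. -/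

import Mathlib

open Finset

/-- The q-Pochhammer symbol `(x;q)_k = ∏_{j=0}^{k-1} (1 - x q^j)`. -/
noncomputable def qPoch (x q : ℂ) (k : ℕ) : ℂ := ∏ j ∈ Finset.range k, (1 - x * q ^ j)

/-- The summand `f_k(a,q;ℓ1,ℓ2)`. -/
noncomputable def f (a q : ℂ) (l1 l2 : ℤ) (k : ℕ) : ℂ :=
  qPoch (q ^ l1 * a) q k * qPoch (q ^ (1 - l1) * a) q k *
    qPoch (q ^ l2 * a) q k * qPoch (q ^ (1 - l2) * a) q k * q ^ k /
    (qPoch (q * a) q k) ^ 4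

/-- The truncated sum `F_n(a,q;ℓ1,ℓ2)`. -/
noncomputable def F (n : ℕ) (a q : ℂ) (l1 l2 : ℤ) : ℂ :=
  ∑ k ∈ Finset.range n, f a q l1 l2 k

lemma qPoch_succ (x q : ℂ) (k : ℕ) : qPoch x q (k + 1) = qPoch x q k * (1 - x * q ^ k) :=
  prod_range_succ _ _

lemma one_sub_mul_qPoch_mul (x q : ℂ) (k : ℕ) :
    (1 - x) * qPoch (q * x) q k = qPoch x q k * (1 - x * q ^ k) := by
  rw [← qPoch_succ, qPoch, qPoch, prod_range_succ', pow_zero, mul_one, mul_comm]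
  congr 1
  exact prod_congr rfl fun j _ ↦ by ring

/-- Over a full period the `q`-Pochhammer symbol is invariant under `x ↦ q ^ m * x`. -/
lemma qPoch_zpow_mul {n : ℕ} {a q : ℂ} (hq : q ≠ 0) (hqn : q ^ n = 1)
    (ha : ∀ m : ℤ, 1 - q ^ m * a ≠ 0) (m : ℤ) : qPoch (q ^ m * a) q n = qPoch a q n := by
  have step (m : ℤ) : qPoch (q ^ (m + 1) * a) q n = qPoch (q ^ m * a) q n := by
    have h := one_sub_mul_qPoch_mul (q ^ m * a) q n
    rw [hqn, mul_one, mul_comm (qPoch _ _ _)] at h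
    rw [zpow_add_one₀ hq, mul_comm (q ^ m) q, mul_assoc]
    exact mul_left_cancel₀ (ha m) h
  induction m using Int.induction_on with
  | zero => simp
  | succ i ih => rw [step, ih]
  | pred i ih => rw [← ih, ← step (-i - 1), sub_add_cancel]

lemma qPoch_ne_zero {a q : ℂ} (ha : ∀ m : ℤ, 1 - q ^ m * a ≠ 0) (k : ℕ) :
    qPoch (q * a) q k ≠ 0 :=
  prod_ne_zero_iff.2 fun j _ ↦ by
    convert ha (j + 1 : ℕ) using 2
    rw [zpow_natCast]
    ring

lemma f_period {n : ℕ} {a q : ℂ} (hq : q ≠ 0) (hqn : q ^ n = 1)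
    (ha : ∀ m : ℤ, 1 - q ^ m * a ≠ 0) (m : ℤ) : f a q m m n = f a q m m 0 := by
  have h := qPoch_ne_zero ha n
  have h1 : qPoch (q * a) q n = qPoch a q n := by simpa using qPoch_zpow_mul hq hqn ha 1
  rw [h1] at h
  simp only [f, qPoch_zpow_mul hq hqn ha, h1, hqn]
  simp only [qPoch, range_zero, prod_empty, pow_zero] at h ⊢
  field_simp

lemma f_succ {a q : ℂ} (hq : q ≠ 0) (ha : ∀ m : ℤ, 1 - q ^ m * a ≠ 0) (m : ℤ) (k : ℕ) :
    f a q m m (k + 1) * ((1 - q * (a * q ^ k)) ^ 2 * q ^ m) ^ 2 =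
      f a q m m k * q * ((1 - q ^ m * (a * q ^ k)) * (q ^ m - q * (a * q ^ k))) ^ 2 := by
  have h := qPoch_ne_zero ha k
  have h' := qPoch_ne_zero ha (k + 1)
  have hm : q ^ m ≠ 0 := zpow_ne_zero m hq
  simp only [f, qPoch_succ, zpow_sub₀ hq, zpow_one] at h' ⊢
  have h2 : 1 - q * a * q ^ k ≠ 0 := right_ne_zero_of_mul h'
  have e : q * (a * q ^ k) = q * a * q ^ k := by ring
  rw [e]
  have e2 : 1 - q / q ^ m * a * q ^ k = (q ^ m - q * a * q ^ k) / q ^ m := by field_simp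
  rw [e2]
  generalize qPoch (q ^ m * a) q k = u
  generalize qPoch (q / q ^ m * a) q k = v
  generalize qPoch (q * a) q k = w at *
  generalize q ^ m = L at *
  rw [pow_succ]
  generalize q ^ k = x at *
  generalize h3 : 1 - q * a * x = d at *
  field_simp

lemma f_shift {a q : ℂ} (hq : q ≠ 0) (m : ℤ) (k : ℕ) :
    f a q (m + 1) (m + 1) k * ((1 - q ^ m * a) * (q ^ m - a * q ^ k)) ^ 2 =
      f a q m m k * ((1 - q ^ m * (a * q ^ k)) * (q ^ m - a)) ^ 2 := by
  have hm : q ^ m ≠ 0 := zpow_ne_zero m hq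
  have h1 := one_sub_mul_qPoch_mul (q ^ m * a) q k
  have h2 := one_sub_mul_qPoch_mul ((q ^ m)⁻¹ * a) q k
  have e1 : q ^ (m + 1) * a = q * (q ^ m * a) := by rw [zpow_add_one₀ hq]; ring
  have e2 : q ^ (1 - (m + 1)) * a = (q ^ m)⁻¹ * a := by rw [← zpow_neg]; congr 2; ring
  have e3 : q ^ (1 - m) * a = q * ((q ^ m)⁻¹ * a) := by
    rw [zpow_sub₀ hq, zpow_one]; ring
  simp only [f, e1, e2, e3]
  have h2' : (q ^ m - a) * qPoch (q * ((q ^ m)⁻¹ * a)) q k =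
      qPoch ((q ^ m)⁻¹ * a) q k * (q ^ m - a * q ^ k) := by
    field_simp at h2 ⊢
    linear_combination h2
  generalize qPoch (q * ((q ^ m)⁻¹ * a)) q k = v at *
  generalize qPoch ((q ^ m)⁻¹ * a) q k = v' at *
  generalize qPoch (q * (q ^ m * a)) q k = u' at *
  generalize qPoch (q ^ m * a) q k = u at *
  generalize q ^ m = L at *
  calc _ = (((1 - L * a) * u') * (v' * (L - a * q ^ k))) ^ 2 * q ^ k / qPoch (q * a) q k ^ 4 := by
        ring
    _ = _ := by rw [h1, ← h2']; ring

/-- The polynomial part of the Gosper certificate, with `L = q ^ ℓ` and `y = a * q ^ k`. -/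
def certPoly (q L y : ℂ) : ℂ :=
  q * L ^ 2 * (1 - q * L ^ 2) * (1 + L) * (1 + q * L) *
    (-(q ^ 2 * L ^ 2 * (4 + 14 * L + 2 * q * L + 4 * q * L ^ 2)) +
      (1 + 4 * L + L ^ 2 + 4 * q * L + 13 * q * L ^ 2 + q * L ^ 4 + q ^ 2 * L ^ 2 +
        13 * q ^ 2 * L ^ 4 + 4 * q ^ 2 * L ^ 5 + q ^ 3 * L ^ 4 + 4 * q ^ 3 * L ^ 5 +
        q ^ 3 * L ^ 6) * y -
      L ^ 2 * (4 + 2 * L + 14 * q * L + 4 * q * L ^ 2) * y ^ 2)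

/-- The Gosper certificate for the recurrence in `ℓ`. -/
noncomputable def cert (a q : ℂ) (m : ℤ) (k : ℕ) : ℂ :=
  f a q m m k * ((a - q ^ m) * (a - q * q ^ m)) ^ 2 * (1 - a * q ^ k) ^ 4 *
    certPoly q (q ^ m) (a * q ^ k) /
    (a * q ^ k * ((q ^ m - a * q ^ k) * (q * q ^ m - a * q ^ k)) ^ 2)

/-- The coefficient of `F (ℓ + 2)` in the recurrence, up to sign and factors involving `a`. -/
def coeffTwo (q L : ℂ) : ℂ :=
  q * L ^ 2 * (1 + L) * (1 + 4 * L + L ^ 2) * (1 - q * L) ^ 3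

/-- The coefficient of `F (ℓ + 1)` in the recurrence, up to factors involving `a`. -/
def coeffOne (q L : ℂ) : ℂ :=
  (1 - q * L ^ 2) *
    (1 + 5 * (1 + q) * L + (5 + 16 * q + 5 * q ^ 2) * L ^ 2 +
      (1 + q) * (1 - 5 * q + q ^ 2) * L ^ 3 -
      2 * q * (3 + 25 * q + 3 * q ^ 2) * L ^ 4 +
      q * (1 + q) * (1 - 5 * q + q ^ 2) * L ^ 5 +
      q ^ 2 * (5 + 16 * q + 5 * q ^ 2) * L ^ 6 +
      5 * q ^ 3 * (1 + q) * L ^ 7 + q ^ 4 * L ^ 8)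

/-- The coefficient of `F ℓ` in the recurrence, up to sign and factors involving `a`. -/
def coeffZero (q L : ℂ) : ℂ :=
  q * L ^ 2 * (1 - L) ^ 3 * (1 + q * L) * (1 + 4 * q * L + q ^ 2 * L ^ 2)

lemma certPoly_gosper (q L y : ℂ) :
    certPoly q L (q * y) * ((1 - L * y) * (q * L - y)) ^ 2 -
        q ^ 2 * L ^ 2 * (1 - y) ^ 4 * certPoly q L y =
      q ^ 2 * L ^ 2 * y * (-coeffTwo q L * ((1 - L * y) * (1 - q * L * y)) ^ 2 +
        coeffOne q L * ((1 - L * y) * (q * L - y)) ^ 2 -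
        coeffZero q L * ((L - y) * (q * L - y)) ^ 2) := by
  simp only [certPoly, coeffTwo, coeffOne, coeffZero]
  ring

lemma sub_ne_zero_of_forall {a q : ℂ} (hq : q ≠ 0) (ha : ∀ m : ℤ, 1 - q ^ m * a ≠ 0)
    (m : ℤ) (k : ℕ) : q ^ m - a * q ^ k ≠ 0 := by
  have h : q ^ m - a * q ^ k = q ^ m * (1 - q ^ ((k : ℤ) - m) * a) := by
    rw [zpow_sub₀ hq, zpow_natCast]
    have := zpow_ne_zero m hq
    field_simp
  rw [h]
  exact mul_ne_zero (zpow_ne_zero m hq) (ha _)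

lemma cert_succ {a q : ℂ} (hq : q ≠ 0) (ha0 : a ≠ 0) (ha : ∀ m : ℤ, 1 - q ^ m * a ≠ 0)
    (m : ℤ) (k : ℕ) :
    cert a q m (k + 1) =
      f a q m m k * ((a - q ^ m) * (a - q * q ^ m)) ^ 2 *
        (certPoly q (q ^ m) (q * (a * q ^ k)) *
          ((1 - q ^ m * (a * q ^ k)) * (q * q ^ m - a * q ^ k)) ^ 2) /
        (q ^ 2 * (q ^ m) ^ 2 * (a * q ^ k) *
          ((q ^ m - a * q ^ k) * (q * q ^ m - a * q ^ k)) ^ 2) := by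
  have hs := f_succ hq ha m k
  have hm : q ^ m ≠ 0 := zpow_ne_zero m hq
  have hy : a * q ^ k ≠ 0 := mul_ne_zero ha0 (pow_ne_zero k hq)
  have n0 := sub_ne_zero_of_forall hq ha m k
  have n1 := sub_ne_zero_of_forall hq ha (m + 1) k
  have n2 := sub_ne_zero_of_forall hq ha m (k + 1)
  have n3 := ha (k + 1 : ℕ)
  rw [zpow_add_one₀ hq, mul_comm (q ^ m) q] at n1
  have e : a * q ^ (k + 1) = q * (a * q ^ k) := by ring
  rw [zpow_natCast, mul_comm, e] at n3
  rw [e] at n2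
  rw [cert, e]
  generalize f a q m m (k + 1) = g' at *
  generalize f a q m m k = g at *
  generalize q ^ m = L at *
  generalize a * q ^ k = y at *
  generalize certPoly q L (q * y) = p
  have hg : g' = g * q * ((1 - L * y) * (L - q * y)) ^ 2 / ((1 - q * y) ^ 2 * L) ^ 2 := by
    rw [eq_div_iff (by positivity), hs]
  rw [hg]
  have e2 : q * L - q * y = q * (L - y) := by ring
  rw [e2]
  field_simp

lemma f_recurrence {a q : ℂ} (hq : q ≠ 0) (ha0 : a ≠ 0) (ha : ∀ m : ℤ, 1 - q ^ m * a ≠ 0)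
    (m : ℤ) (k : ℕ) :
    -(coeffTwo q (q ^ m) * (1 - q ^ m * a) ^ 2 * (1 - q * q ^ m * a) ^ 2) *
          f a q (m + 2) (m + 2) k +
        coeffOne q (q ^ m) * (1 - q ^ m * a) ^ 2 * (a - q * q ^ m) ^ 2 *
          f a q (m + 1) (m + 1) k -
        coeffZero q (q ^ m) * (a - q ^ m) ^ 2 * (a - q * q ^ m) ^ 2 * f a q m m k =
      cert a q m (k + 1) - cert a q m k := by
  have h1 := f_shift (a := a) hq m k
  have h2 := f_shift (a := a) hq (m + 1) k
  have hm : q ^ m ≠ 0 := zpow_ne_zero m hq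
  have hy : a * q ^ k ≠ 0 := mul_ne_zero ha0 (pow_ne_zero k hq)
  have n0 := sub_ne_zero_of_forall hq ha m k
  have n1 := sub_ne_zero_of_forall hq ha (m + 1) k
  rw [cert_succ hq ha0 ha, cert]
  rw [zpow_add_one₀ hq, mul_comm (q ^ m) q] at n1 h2
  rw [show m + 1 + 1 = m + 2 by ring] at h2
  have hP := certPoly_gosper q (q ^ m) (a * q ^ k)
  generalize f a q (m + 2) (m + 2) k = g₂ at *
  generalize f a q (m + 1) (m + 1) k = g₁ at *
  generalize f a q m m k = g at *
  generalize q ^ m = L at *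
  generalize a * q ^ k = y at *
  generalize certPoly q L (q * y) = p' at *
  generalize certPoly q L y = p at *
  generalize coeffTwo q L = c₂ at *
  generalize coeffOne q L = c₁ at *
  generalize coeffZero q L = c₀ at *
  have h3 : (1 - L * a) ^ 2 * (1 - q * L * a) ^ 2 * g₂ *
      ((L - y) * (q * L - y)) ^ 2 =
      g * ((1 - L * y) * (L - a) * ((1 - q * L * y) * (q * L - a))) ^ 2 := by
    linear_combination ((1 - L * a) * (L - y)) ^ 2 * h2 +
      ((1 - q * L * y) * (q * L - a)) ^ 2 * h1
  calc _ = g * ((a - L) * (a - q * L)) ^ 2 *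
        (-c₂ * ((1 - L * y) * (1 - q * L * y)) ^ 2 + c₁ * ((1 - L * y) * (q * L - y)) ^ 2 -
          c₀ * ((L - y) * (q * L - y)) ^ 2) / ((L - y) * (q * L - y)) ^ 2 := by
        rw [eq_div_iff (pow_ne_zero 2 (mul_ne_zero n0 n1))]
        linear_combination -c₂ * h3 + c₁ * ((a - q * L) * (q * L - y)) ^ 2 * h1
    _ = g * ((a - L) * (a - q * L)) ^ 2 *
        (q ^ 2 * L ^ 2 * y * (-c₂ * ((1 - L * y) * (1 - q * L * y)) ^ 2 +
          c₁ * ((1 - L * y) * (q * L - y)) ^ 2 - c₀ * ((L - y) * (q * L - y)) ^ 2)) /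
        (q ^ 2 * L ^ 2 * y * ((L - y) * (q * L - y)) ^ 2) := by
        field_simp
    _ = _ := by
        rw [← hP]
        field_simp

lemma cert_period {n : ℕ} {a q : ℂ} (hq : q ≠ 0) (hqn : q ^ n = 1)
    (ha : ∀ m : ℤ, 1 - q ^ m * a ≠ 0) (m : ℤ) : cert a q m n = cert a q m 0 := by
  simp only [cert, f_period hq hqn ha, hqn, pow_zero]

lemma f_zero_left (q : ℂ) (l₁ l₂ : ℤ) (k : ℕ) : f 0 q l₁ l₂ k = q ^ k := by
  simp [f, qPoch]

theorem stmt_10 (n : ℕ) (hn : 1 ≤ n) (ζ : ℂ) (hζ : IsPrimitiveRoot ζ n)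
    (a : ℂ) (ha : a ^ n ≠ 1) (l : ℕ) (q L : ℂ) (hq : q = ζ) (hL : L = ζ ^ l) :
    -(q * L ^ 2 * (1 + L) * (1 + 4 * L + L ^ 2) * (1 - q * L) ^ 3 *
          (1 - L * a) ^ 2 * (1 - q * L * a) ^ 2) * F n a ζ (l + 2) (l + 2) +
      (1 - q * L ^ 2) *
        (1 + 5 * (1 + q) * L + (5 + 16 * q + 5 * q ^ 2) * L ^ 2 +
          (1 + q) * (1 - 5 * q + q ^ 2) * L ^ 3 -
          2 * q * (3 + 25 * q + 3 * q ^ 2) * L ^ 4 +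
          q * (1 + q) * (1 - 5 * q + q ^ 2) * L ^ 5 +
          q ^ 2 * (5 + 16 * q + 5 * q ^ 2) * L ^ 6 +
          5 * q ^ 3 * (1 + q) * L ^ 7 + q ^ 4 * L ^ 8) *
        (1 - L * a) ^ 2 * (a - q * L) ^ 2 * F n a ζ (l + 1) (l + 1) -
      q * L ^ 2 * (1 - L) ^ 3 * (1 + q * L) * (1 + 4 * q * L + q ^ 2 * L ^ 2) *
        (a - L) ^ 2 * (a - q * L) ^ 2 * F n a ζ l l = 0 := by
  subst hq hL
  have hq0 : q ≠ 0 := hζ.ne_zero (by lia)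
  have hqn : q ^ n = 1 := hζ.pow_eq_one
  have hne (m : ℤ) : 1 - q ^ m * a ≠ 0 := fun h ↦ ha <| by
    have h' : (q ^ m * a) ^ n = 1 := by rw [← sub_eq_zero.1 h, one_pow]
    rwa [mul_pow, ← zpow_natCast, zpow_comm, zpow_natCast, hqn, one_zpow, one_mul] at h'
  by_cases ha0 : a = 0
  · subst ha0
    simp only [F, f_zero_left]
    rcases hn.eq_or_lt with rfl | hn
    · obtain rfl : q = 1 := by simpa using hqn
      simp
    · simp [hζ.geom_sum_eq_zero hn]
  · have h := sum_congr rfl fun k (_ : k ∈ range n) ↦ f_recurrence hq0 ha0 hne l k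
    rw [sum_range_sub, cert_period hq0 hqn hne, sub_self, sum_sub_distrib, sum_add_distrib,
      ← mul_sum, ← mul_sum, ← mul_sum, zpow_natCast] at h
    exact h
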